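/- There exist sock sequences p and q such that q contains p as a pattern, φ_{aba}(q) is sorted, but φ_{aba}(p) is not sorted. Concretely, for pairwise distinct socks a, b, c, one may take p = abcabc and q = babcabc: then φ_{aba}(abcabc) = cbcbaa, which is not sorted, while φ_{aba}(babcabc) = aaccbbb, which is sorted. Hence the set of sock sequences that are 1-stack-sortable under φ_{aba} is not closed under pattern containment. -/

import Mathlib

attribute [local instance] Classical.propDecidable

/-- Two lists have the same shape: same length and identical equality pattern
of entries (`q_i = q_j` iff `r_i = r_j`). -/
def SameShape {A : Type*} {B : Type*} (q : List A) (r : List B) : Prop :=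
  q.length = r.length ∧ ∀ i j : ℕ, (q[i]? = q[j]? ↔ r[i]? = r[j]?)

/-- `ContainsPat p σ` : the sock sequence `p` contains the pattern `σ`
(not necessarily consecutively): there are indices `i_1 < ⋯ < i_m` such that
`p_{i_j} = p_{i_k} ↔ σ_j = σ_k`. -/
def ContainsPat {A : Type*} {B : Type*} (p : List A) (σ : List B) : Prop :=
  ∃ q : List A, q.Sublist p ∧ SameShape q σ

/-- A sock sequence is sorted if all occurrences of each sock appear
consecutively. -/
def SortedSocks {A : Type*} (p : List A) : Prop :=
  ∀ i j k : ℕ, i ≤ j → j ≤ k → p[i]? = p[k]? → p[j]? = p[i]?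

/-- One pass of the deterministic σ-avoiding stack-sorting procedure:
`sortAux σ input stack` runs the σ-avoiding stack with the given remaining
input and current stack (stack listed from top to bottom), returning the rest
of the output.  If input remains and pushing the next input sock onto the
stack does not create a σ-pattern in the stack, that sock is pushed; otherwise
the top sock of the stack is popped to the output. -/
noncomputable def sortAux {A : Type*} {B : Type*} (σ : List B) : List A → List A → List A
  | [], stack => stack
  | x :: input, stack =>
    if ContainsPat (x :: stack) σ then
      match stack with
      | [] => sortAux σ input [x]
      | t :: rest => t :: sortAux σ (x :: input) rest
    else
      sortAux σ input (x :: stack)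
termination_by input stack => 2 * input.length + stack.length
decreasing_by all_goals simp only [List.length_cons]; omega

/-- The deterministic σ-avoiding stack-sorting map `φ_σ`. -/
noncomputable def phi {A : Type*} {B : Type*} (σ : List B) (p : List A) : List A :=
  sortAux σ p []

/-- The pattern `aba`: first and third socks equal, distinct from the second. -/
def abaPat : List ℕ := [0, 1, 0]

theorem containsPat_abaPat_iff {A : Type*} (s : List A) :
    ContainsPat s abaPat ↔ ∃ x y : A, x ≠ y ∧ [x, y, x].Sublist s := by
  constructor
  · rintro ⟨q, hq, hlen, h⟩
    obtain ⟨x, y, z, rfl⟩ := List.length_eq_three.mp hlen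
    have hxz : x = z := by simpa [abaPat] using h 0 2
    have hxy : x ≠ y := by simpa [abaPat] using h 0 1
    exact ⟨x, y, hxy, hxz ▸ hq⟩
  · rintro ⟨x, y, hxy, hs⟩
    refine ⟨_, hs, rfl, fun i j => ?_⟩
    rcases i with _ | _ | _ | i <;> rcases j with _ | _ | _ | j <;>
      simp [abaPat, hxy, hxy.symm]

/-- Pushing `x` onto a stack avoiding `aba` creates the pattern only with `x` as its first sock. -/
theorem containsPat_cons_abaPat_iff {A : Type*} (x : A) (s : List A) :
    ContainsPat (x :: s) abaPat ↔
      (∃ y, x ≠ y ∧ [y, x].Sublist s) ∨ ContainsPat s abaPat := by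
  simp only [containsPat_abaPat_iff, List.cons_sublist_cons']
  constructor
  · rintro ⟨u, v, huv, h | ⟨rfl, h⟩⟩
    · exact Or.inr ⟨u, v, huv, h⟩
    · exact Or.inl ⟨v, huv, h⟩
  · rintro (⟨y, hy, h⟩ | ⟨u, v, huv, h⟩)
    · exact ⟨x, y, hy, Or.inr ⟨rfl, h⟩⟩
    · exact ⟨u, v, huv, Or.inl h⟩

theorem not_containsPat_nil_abaPat {A : Type*} : ¬ ContainsPat ([] : List A) abaPat := by
  simp [containsPat_abaPat_iff]

theorem exists_ne_pair_sublist_cons_iff {A : Type*} (x t : A) (s : List A) :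
    (∃ y, x ≠ y ∧ [y, x].Sublist (t :: s)) ↔
      (x ≠ t ∧ x ∈ s) ∨ ∃ y, x ≠ y ∧ [y, x].Sublist s := by
  simp only [List.cons_sublist_cons', List.singleton_sublist]
  constructor
  · rintro ⟨y, hy, h | ⟨rfl, h⟩⟩
    · exact Or.inr ⟨y, hy, h⟩
    · exact Or.inl ⟨hy, h⟩
  · rintro (⟨hy, h⟩ | ⟨y, hy, h⟩)
    · exact ⟨t, hy, Or.inr ⟨rfl, h⟩⟩
    · exact ⟨y, hy, Or.inl h⟩

theorem not_exists_ne_pair_sublist_nil {A : Type*} (x : A) :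
    ¬ ∃ y, x ≠ y ∧ [y, x].Sublist [] := by
  simp

/-- Sortability under `φ_{aba}` is not closed under pattern containment: for
pairwise distinct socks `a, b, c`, the sequence `q = babcabc` contains
`p = abcabc` as a pattern, `φ_{aba}(q) = aaccbbb` is sorted, but
`φ_{aba}(p) = cbcbaa` is not sorted. -/
theorem not_closed_under_containment {A : Type*} (a b c : A)
    (hab : a ≠ b) (hac : a ≠ c) (hbc : b ≠ c) :
    ContainsPat [b, a, b, c, a, b, c] [a, b, c, a, b, c] ∧
    phi abaPat [a, b, c, a, b, c] = [c, b, c, b, a, a] ∧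
    ¬ SortedSocks (phi abaPat [a, b, c, a, b, c]) ∧
    phi abaPat [b, a, b, c, a, b, c] = [a, a, c, c, b, b, b] ∧
    SortedSocks (phi abaPat [b, a, b, c, a, b, c]) := by
  have hp : phi abaPat [a, b, c, a, b, c] = [c, b, c, b, a, a] := by
    simp only [phi, sortAux, containsPat_cons_abaPat_iff, not_containsPat_nil_abaPat,
      exists_ne_pair_sublist_cons_iff, not_exists_ne_pair_sublist_nil]
    simp [hab, hac, hab.symm, hac.symm, hbc.symm]
  have hq : phi abaPat [b, a, b, c, a, b, c] = [a, a, c, c, b, b, b] := by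
    simp only [phi, sortAux, containsPat_cons_abaPat_iff, not_containsPat_nil_abaPat,
      exists_ne_pair_sublist_cons_iff, not_exists_ne_pair_sublist_nil]
    simp [hab, hac, hbc, hab.symm, hbc.symm]
  refine ⟨⟨_, List.sublist_cons_self _ _, rfl, fun _ _ => Iff.rfl⟩, hp, ?_, hq, ?_⟩
  · rw [hp]
    intro h
    exact hbc (by simpa using h 0 1 2 (by simp) (by simp) rfl)
  · rw [hq]
    intro i j k hij hjk h
    by_cases hk : k < 7
    · interval_cases k <;> interval_cases j <;> interval_cases i <;>
        simp_all
    · have hi : 7 ≤ i := by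
        rw [List.getElem?_eq_none (i := k) (by simpa using hk)] at h
        simpa using h
      rw [List.getElem?_eq_none (by simpa using hi.trans hij),
        List.getElem?_eq_none (by simpa using hi)]
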